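/- Let P be a finite nonempty subset of a metric space M, let k, ℓ be integers with 1 ≤ ℓ ≤ k ≤ |P|, and set m = ⌊k/ℓ⌋, with m ≥ 2. Let q_1, …, q_m be a Gonzalez sequence in P, and let C ⊆ P be such that for every i, C contains at least ℓ points of P each within distance dist_ℓ(P, q_i) of q_i (equivalently, dist_ℓ(C, q_i) = dist_ℓ(P, q_i)). Then max_{p ∈ P} dist_ℓ(C, p) ≤ 4·r_opt, where r_opt is the optimal fault-tolerant k-center cost of P with fault-tolerance parameter ℓ; moreover, if ℓ divides k the bound improves to 3·r_opt. -/

import Mathlib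

/-- `kthDist S p i` is the `i`-th smallest value (1-indexed) among the distances
`dist p s` for `s ∈ S`, i.e. the radius of the smallest closed ball centered at `p`
containing at least `i` points of `S`. -/
noncomputable def kthDist {M : Type*} [MetricSpace M] (S : Finset M) (p : M) (i : ℕ) : ℝ :=
  ((S.val.map (fun s => dist p s)).sort (· ≤ ·)).getD (i - 1) 0

theorem List.getElem_le_iff_lt_countP {α : Type*} [LinearOrder α] (r : α) :
    ∀ (L : List α), L.Pairwise (· ≤ ·) → ∀ (j : ℕ) (hj : j < L.length),
      L[j] ≤ r ↔ j < L.countP (fun x => decide (x ≤ r))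
  | [], _, j, hj => by simp at hj
  | a :: L, hL, j, hj => by
    rw [List.pairwise_cons] at hL
    obtain ⟨ha, hL⟩ := hL
    by_cases har : a ≤ r
    · rw [List.countP_cons_of_pos (by simpa using har)]
      cases j with
      | zero => simpa using har
      | succ j =>
        simpa using List.getElem_le_iff_lt_countP r L hL j (by simpa using hj)
    · have h0 : L.countP (fun x => decide (x ≤ r)) = 0 := by
        rw [List.countP_eq_zero]
        intro b hb
        simpa using (not_le.mp har).trans_le (ha b hb)
      rw [List.countP_cons_of_neg (by simpa using har), h0]
      cases j with
      | zero => simpa using har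
      | succ j =>
        have := ha _ (List.getElem_mem (l := L) (n := j) (by simpa using hj))
        simpa using (not_le.mp har).trans_le this

theorem kthDist_le_iff {M : Type*} [MetricSpace M] {S : Finset M} {p : M} {i : ℕ} {r : ℝ}
    (hi : 1 ≤ i) (hiS : i ≤ S.card) :
    kthDist S p i ≤ r ↔ i ≤ (S.filter (fun x => dist p x ≤ r)).card := by
  have hlen : i - 1 < ((S.val.map (fun s => dist p s)).sort (· ≤ ·)).length := by
    simp; omega
  have hcount : ((S.val.map (fun s => dist p s)).sort (· ≤ ·)).countP
      (fun x => decide (x ≤ r)) = (S.filter (fun x => dist p x ≤ r)).card := by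
    rw [← Multiset.coe_countP, Multiset.sort_eq, Multiset.countP_map]
    rfl
  rw [kthDist, List.getD_eq_getElem _ _ hlen,
    List.getElem_le_iff_lt_countP r _ (Multiset.pairwise_sort _ _), hcount]
  omega

/-- Points whose closed `r`-balls each contain `ℓ` points of `S`, with pairwise distances
exceeding `2 * r`, number at most `|S| / ℓ`. -/
theorem Finset.card_mul_le_of_pairwise_two_mul_lt_dist {M ι : Type*} [MetricSpace M]
    [DecidableEq M] {S : Finset M} {T : Finset ι} {f : ι → M} {ℓ : ℕ} {r : ℝ}
    (hball : ∀ i ∈ T, ℓ ≤ (S.filter (fun x => dist (f i) x ≤ r)).card)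
    (hsep : (T : Set ι).Pairwise fun i j => 2 * r < dist (f i) (f j)) :
    T.card * ℓ ≤ S.card := by
  have hdisj : (T : Set ι).PairwiseDisjoint
      fun i => S.filter (fun x => dist (f i) x ≤ r) := by
    intro i hi j hj hij
    refine Finset.disjoint_left.mpr fun x hxi hxj => ?_
    have h1 := (Finset.mem_filter.mp hxi).2
    have h2 := (Finset.mem_filter.mp hxj).2
    have h3 := hsep hi hj hij
    have h4 := dist_triangle_right (f i) (f j) x
    linarith
  calc T.card * ℓ ≤ ∑ i ∈ T, (S.filter (fun x => dist (f i) x ≤ r)).card := by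
        simpa using Finset.card_nsmul_le_sum T _ ℓ hball
    _ = (T.biUnion fun i => S.filter (fun x => dist (f i) x ≤ r)).card :=
        (Finset.card_biUnion hdisj).symm
    _ ≤ S.card := Finset.card_le_card
        (Finset.biUnion_subset.mpr fun i _ => Finset.filter_subset _ _)

/-- If every point of `P` has `ℓ` points of `S` within distance `r`, then a Gonzalez sequence of
length `m` in `P` with `|S| < (m + 1) * ℓ` comes within `2 * r` of every point of `P`. -/
theorem exists_dist_le_two_mul_of_gonzalez {M : Type*} [MetricSpace M] [DecidableEq M]
    {P S : Finset M} {m ℓ : ℕ} {r : ℝ} {q : ℕ → M} (hq1 : q 1 ∈ P)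
    (hgonz : ∀ i, 2 ≤ i → i ≤ m → q i ∈ P ∧
      ∀ p ∈ P, Metric.infDist p (((Finset.Icc 1 (i - 1)).image q : Finset M) : Set M) ≤
        Metric.infDist (q i) (((Finset.Icc 1 (i - 1)).image q : Finset M) : Set M))
    (hball : ∀ p ∈ P, ℓ ≤ (S.filter (fun x => dist p x ≤ r)).card)
    (hS : S.card < (m + 1) * ℓ) {p : M} (hp : p ∈ P) :
    ∃ i, 1 ≤ i ∧ i ≤ m ∧ dist p (q i) ≤ 2 * r := by
  by_contra! hfar
  have hqsep : ∀ i j, 1 ≤ i → i < j → j ≤ m → 2 * r < dist (q j) (q i) := by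
    intro i j hi hij hj
    have hne : (((Finset.Icc 1 (j - 1)).image q : Finset M) : Set M).Nonempty :=
      ⟨q i, by simp only [Finset.coe_image, Finset.coe_Icc]
               exact ⟨i, ⟨hi, by omega⟩, rfl⟩⟩
    have hcpt : IsCompact (((Finset.Icc 1 (j - 1)).image q : Finset M) : Set M) :=
      (Finset.finite_toSet _).isCompact
    obtain ⟨y, hy, hyd⟩ := hcpt.exists_infDist_eq_dist hne p
    obtain ⟨a, ha, rfl⟩ := Finset.mem_image.mp (Finset.mem_coe.mp hy)
    rw [Finset.mem_Icc] at ha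
    calc 2 * r < dist p (q a) := hfar a ha.1 (by omega)
      _ = _ := hyd.symm
      _ ≤ _ := (hgonz j (by omega) hj).2 p hp
      _ ≤ dist (q j) (q i) := Metric.infDist_le_dist_of_mem (by
          simp only [Finset.coe_image, Finset.coe_Icc]
          exact ⟨i, ⟨hi, by omega⟩, rfl⟩)
  have hqP : ∀ i, 1 ≤ i → i ≤ m → q i ∈ P := by
    intro i hi him
    rcases hi.eq_or_lt with rfl | h
    · exact hq1
    · exact (hgonz i h him).1
  let f : ℕ → M := fun i => if i = 0 then p else q i
  have hlt : ∀ i j, i < j → j ≤ m → 2 * r < dist (f j) (f i) := by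
    intro i j hij hj
    have hj0 : j ≠ 0 := by omega
    by_cases hi : i = 0
    · simpa [f, hi, hj0, dist_comm] using hfar j (by omega) hj
    · simpa [f, hi, hj0] using hqsep i j (by omega) hij hj
  have hcard := Finset.card_mul_le_of_pairwise_two_mul_lt_dist
    (S := S) (T := Finset.range (m + 1)) (f := f) (ℓ := ℓ) (r := r)
    (fun i hi => hball _ (by
      rw [Finset.mem_range] at hi
      by_cases h : i = 0
      · simpa [f, h] using hp
      · simpa [f, h] using hqP i (by omega) (by omega)))
    (fun i hi j hj hij => by
      simp only [Finset.coe_range, Set.mem_Iio] at hi hj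
      rcases hij.lt_or_gt with h | h
      · rw [dist_comm]
        exact hlt i j h (by omega)
      · exact hlt j i h (by omega))
  rw [Finset.card_range] at hcard
  omega

/-- Let `P` be a finite nonempty subset of a metric space,
`1 ≤ ℓ ≤ k ≤ |P|`, and `m = ⌊k/ℓ⌋ ≥ 2`.  Let `q 1, …, q m` be a Gonzalez sequence in `P`,
and let `C ⊆ P` be such that for every `i`, `C` contains at least `ℓ` points of `P` each
within distance `dist_ℓ(P, q i)` of `q i`.  Then `max_{p ∈ P} dist_ℓ(C, p) ≤ 4·r_opt`,
where `r_opt` is the optimal fault-tolerant `k`-center cost of `P` with fault-tolerance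
parameter `ℓ`; moreover, if `ℓ ∣ k` the bound improves to `3·r_opt`. -/
theorem gonzalez_four_approx {M : Type*} [MetricSpace M] [DecidableEq M]
    (P : Finset M) (hP : P.Nonempty) (k ℓ : ℕ)
    (hl1 : 1 ≤ ℓ) (hlk : ℓ ≤ k) (hkP : k ≤ P.card)
    (m : ℕ) (hmdef : m = k / ℓ) (hm : 2 ≤ m)
    (ropt : ℝ)
    (hopt : IsLeast {x : ℝ | ∃ C' : Finset M, C' ⊆ P ∧ C'.card = k ∧
      x = P.sup' hP (fun p => kthDist C' p ℓ)} ropt)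
    (q : ℕ → M) (hq1 : q 1 ∈ P)
    (hgonz : ∀ i, 2 ≤ i → i ≤ m → q i ∈ P ∧
      ∀ p ∈ P, Metric.infDist p (((Finset.Icc 1 (i - 1)).image q : Finset M) : Set M) ≤
        Metric.infDist (q i) (((Finset.Icc 1 (i - 1)).image q : Finset M) : Set M))
    (C : Finset M) (hCP : C ⊆ P)
    (hC : ∀ i, 1 ≤ i → i ≤ m →
      ℓ ≤ (C.filter (fun x => dist (q i) x ≤ kthDist P (q i) ℓ)).card) :
    P.sup' hP (fun p => kthDist C p ℓ) ≤ 4 * ropt ∧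
    (ℓ ∣ k → P.sup' hP (fun p => kthDist C p ℓ) ≤ 3 * ropt) := by
  obtain ⟨⟨S, hSP, hSk, hr⟩, -⟩ := hopt
  have hball : ∀ p ∈ P, ℓ ≤ (S.filter (fun x => dist p x ≤ ropt)).card := fun p hp =>
    (kthDist_le_iff hl1 (hSk ▸ hlk)).mp
      (hr ▸ Finset.le_sup' (fun p => kthDist S p ℓ) hp)
  have hr0 : 0 ≤ ropt := by
    obtain ⟨p, hp⟩ := hP
    obtain ⟨x, hx⟩ := Finset.card_pos.mp (hl1.trans (hball p hp))
    exact dist_nonneg.trans (Finset.mem_filter.mp hx).2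
  have hSm : S.card < (m + 1) * ℓ := by
    rw [hSk, hmdef, mul_comm]
    exact Nat.lt_mul_div_succ k hl1
  have h3 : P.sup' hP (fun p => kthDist C p ℓ) ≤ 3 * ropt := by
    refine Finset.sup'_le _ _ fun p hp => ?_
    obtain ⟨i, hi1, him, hd⟩ := exists_dist_le_two_mul_of_gonzalez hq1 hgonz hball hSm hp
    have hqP : q i ∈ P := by
      rcases hi1.eq_or_lt with rfl | h
      · exact hq1
      · exact (hgonz i h him).1
    have hPi : kthDist P (q i) ℓ ≤ ropt :=
      (kthDist_le_iff hl1 (hlk.trans hkP)).mpr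
        ((hball _ hqP).trans (Finset.card_le_card (Finset.filter_subset_filter _ hSP)))
    refine (kthDist_le_iff hl1
      ((hC i hi1 him).trans (Finset.card_le_card (Finset.filter_subset _ _)))).mpr
      ((hC i hi1 him).trans (Finset.card_le_card fun x hx => ?_))
    rw [Finset.mem_filter] at hx ⊢
    refine ⟨hx.1, ?_⟩
    linarith [dist_triangle p (q i) x, hx.2]
  exact ⟨by linarith, fun _ => h3⟩
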